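/- Let n : ℕ, let f : ℝ → ℂ be n-times differentiable on [0, ∞), denote by f^(k) its k-th derivative (with f^(0) = f), suppose for each k ≤ n there exist M_k > 0 and a_k ∈ ℝ with Re s > a_k such that f^(k) is of exponential order (M_k, a_k), and suppose the Laplace transform of f^(k) exists at s for every k ≤ n. Then L[f^(n)](s) = s^n * L[f](s) - ∑_{k=1}^{n} s^{n-k} * f^(k-1)(0) (n-th order differentiation in the time domain). -/

import Mathlib

open MeasureTheory Set

/-- The Laplace transform of `f : ℝ → ℂ` at `s : ℂ`. -/
noncomputable def laplace (f : ℝ → ℂ) (s : ℂ) : ℂ :=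
  ∫ t in Set.Ioi (0 : ℝ), Complex.exp (-(s * t)) * f t

/-- The Laplace transform of `f` exists at `s`. -/
def laplaceExists (f : ℝ → ℂ) (s : ℂ) : Prop :=
  MeasureTheory.IntegrableOn (fun t : ℝ => Complex.exp (-(s * t)) * f t) (Set.Ioi (0 : ℝ))

/-- `f` is of exponential order `(M, a)`. -/
def expOrder (f : ℝ → ℂ) (M a : ℝ) : Prop :=
  0 < M ∧ ∀ t : ℝ, 0 ≤ t → ‖f t‖ ≤ M * Real.exp (a * t)

theorem expOrder.tendsto_exp_neg_mul {f : ℝ → ℂ} {M a : ℝ} {s : ℂ} (hf : expOrder f M a)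
    (ha : a < s.re) :
    Filter.Tendsto (fun t : ℝ => Complex.exp (-(s * t)) * f t) Filter.atTop (nhds 0) := by
  have hbound : Filter.Tendsto (fun t : ℝ => M * Real.exp (-((s.re - a) * t)))
      Filter.atTop (nhds 0) := by
    simpa using (Real.tendsto_exp_neg_atTop_nhds_zero.comp
      (Filter.tendsto_id.const_mul_atTop (sub_pos.2 ha))).const_mul M
  refine squeeze_zero_norm' ?_ hbound
  filter_upwards [Filter.eventually_ge_atTop 0] with t ht
  calc ‖Complex.exp (-(s * t)) * f t‖ = Real.exp (-(s.re * t)) * ‖f t‖ := by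
        simp [Complex.norm_exp]
    _ ≤ Real.exp (-(s.re * t)) * (M * Real.exp (a * t)) := by
        gcongr
        exact hf.2 t ht
    _ = M * Real.exp (-((s.re - a) * t)) := by
        rw [mul_left_comm, ← Real.exp_add]
        ring_nf

theorem laplace_deriv {f : ℝ → ℂ} {s : ℂ} {M a : ℝ}
    (hdiff : ∀ t ∈ Set.Ici (0 : ℝ), DifferentiableAt ℝ f t)
    (ha : a < s.re) (hexp : expOrder f M a)
    (hf : laplaceExists f s) (hf' : laplaceExists (deriv f) s) :
    laplace (deriv f) s = s * laplace f s - f 0 := by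
  have hd : ∀ t ∈ Set.Ici (0 : ℝ), HasDerivAt (fun t : ℝ => Complex.exp (-(s * t)) * f t)
      (Complex.exp (-(s * t)) * deriv f t - s * (Complex.exp (-(s * t)) * f t)) t := by
    intro t ht
    have hker : HasDerivAt (fun t : ℝ => Complex.exp (-(s * t)))
        (Complex.exp (-(s * t)) * -(s * 1)) t :=
      (((hasDerivAt_id t).ofReal_comp.const_mul s).neg).cexp
    exact (hker.mul (hdiff t ht).hasDerivAt).congr_deriv (by ring)
  have hint := integral_Ioi_of_hasDerivAt_of_tendsto' hd (hf'.sub (hf.const_mul s))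
    (hexp.tendsto_exp_neg_mul ha)
  rw [integral_sub hf' (hf.const_mul s), integral_const_mul] at hint
  simp only [Complex.ofReal_zero, mul_zero, neg_zero, Complex.exp_zero, one_mul, zero_sub] at hint
  unfold laplace
  linear_combination hint

/-- n-th order differentiation in the time domain. -/
theorem laplace_iterated_deriv (n : ℕ) (f : ℝ → ℂ) (s : ℂ)
    (hdiff : ∀ k < n, ∀ t ∈ Set.Ici (0 : ℝ), DifferentiableAt ℝ (deriv^[k] f) t)
    (hexp : ∀ k ≤ n, ∃ M a : ℝ, a < s.re ∧ expOrder (deriv^[k] f) M a)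
    (hlap : ∀ k ≤ n, laplaceExists (deriv^[k] f) s) :
    laplace (deriv^[n] f) s =
      s ^ n * laplace f s - ∑ k ∈ Finset.Icc 1 n, s ^ (n - k) * deriv^[k - 1] f 0 := by
  induction n with
  | zero => simp
  | succ n ih =>
    obtain ⟨M, a, ha, hM⟩ := hexp n n.le_succ
    have hn := hlap (n + 1) le_rfl
    rw [Function.iterate_succ_apply'] at hn ⊢
    rw [laplace_deriv (hdiff n n.lt_succ_self) ha hM (hlap n n.le_succ) hn,
      ih (fun k hk => hdiff k (hk.trans n.lt_succ_self))
        (fun k hk => hexp k (hk.trans n.le_succ)) (fun k hk => hlap k (hk.trans n.le_succ)),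
      Finset.sum_Icc_succ_top (by omega)]
    have hsum : ∑ k ∈ Finset.Icc 1 n, s ^ (n + 1 - k) * deriv^[k - 1] f 0 =
        s * ∑ k ∈ Finset.Icc 1 n, s ^ (n - k) * deriv^[k - 1] f 0 := by
      rw [Finset.mul_sum]
      refine Finset.sum_congr rfl fun k hk => ?_
      rw [Nat.sub_add_comm (Finset.mem_Icc.1 hk).2, pow_succ']
      ring
    rw [hsum]
    simp only [Nat.sub_self, pow_zero, one_mul, Nat.add_sub_cancel]
    ring
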